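/- Suppose B_r > 0 for all 1 ≤ r ≤ n−1. Let v ∈ 𝒱 satisfy v_1 = v_2 = … = v_{⌈n/2⌉} (at least ⌈n/2⌉ equal prizes at the top). Then L(v) ≥ 0; consequently, for any strictly increasing function g : ℝ → ℝ and any 0 ≤ θ < θ′ ≤ 1, if x and x′ satisfy g(x) = M(v,θ) and g(x′) = M(v,θ′), then x′ ≥ x (the equilibrium effort increases with loss aversion). -/

import Mathlib

open Finset

/-- Summation by parts against the differences to the value just after the range. -/
theorem sum_Icc_mul_sub_succ (a v : ℕ → ℝ) (N : ℕ) :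
    ∑ s ∈ Icc 1 N, a s * (v s - v (N + 1)) =
      ∑ k ∈ Icc 1 N, (∑ j ∈ Icc 1 k, a j) * (v k - v (k + 1)) := by
  induction N with
  | zero => simp
  | succ N ih =>
    have h : ∑ s ∈ Icc 1 N, a s * (v s - v (N + 1 + 1)) =
        ∑ s ∈ Icc 1 N, a s * (v s - v (N + 1)) +
          (∑ s ∈ Icc 1 N, a s) * (v (N + 1) - v (N + 1 + 1)) := by
      rw [sum_mul, ← sum_add_distrib]
      exact sum_congr rfl fun s _ => by ring
    rw [sum_Icc_succ_top (by omega), sum_Icc_succ_top (by omega), h, ih,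
      sum_Icc_succ_top (by omega) a]
    ring

/-- The pairwise sum of `(β r + β s) * (v s - v r)` in terms of consecutive differences of `v`. -/
theorem sum_pairs_add_mul_sub (β v : ℕ → ℝ) (N : ℕ) :
    ∑ r ∈ Icc 1 N, ∑ s ∈ Ico 1 r, (β r + β s) * (v s - v r) =
      ∑ k ∈ Icc 1 N, (((N : ℝ) - k) * ∑ j ∈ Icc 1 k, β j +
        k * (∑ j ∈ Icc 1 N, β j - ∑ j ∈ Icc 1 k, β j)) * (v k - v (k + 1)) := by
  induction N with
  | zero => simp
  | succ N ih =>
    have hI : Ico 1 (N + 1) = Icc 1 N := by ext; simp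
    rw [sum_Icc_succ_top (by omega), hI, sum_Icc_mul_sub_succ (fun s => β (N + 1) + β s), ih,
      sum_Icc_succ_top (by omega), ← sum_add_distrib, sum_Icc_succ_top (by omega) β]
    push_cast
    rw [sub_self, sub_self, zero_mul, mul_zero, add_zero, zero_mul, add_zero]
    refine sum_congr rfl fun k _ => ?_
    simp only [sum_add_distrib, sum_const, Nat.card_Icc, nsmul_eq_mul, Nat.add_sub_cancel]
    ring

/-- effort increases with loss aversion when at least `⌈n/2⌉` equal
prizes are awarded at the top. Suppose `B r > 0` for `1 ≤ r ≤ n − 1` and the prize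
schedule `v ∈ 𝒱` satisfies `v 1 = v 2 = … = v ⌈n/2⌉`. Then `L(v) ≥ 0`; consequently,
for any strictly increasing `g` and `0 ≤ θ < θ' ≤ 1`, if `g x = M(v,θ)` and
`g x' = M(v,θ')` then `x' ≥ x`. -/
theorem effort_increases_many_equal_top_prizes
    (n : ℕ) (hn : 2 ≤ n) (β : ℕ → ℝ)
    (hβsum : ∑ r ∈ Icc 1 n, β r = 0)
    (B : ℕ → ℝ) (hB : ∀ r, B r = ∑ k ∈ Icc 1 r, β k)
    (hBpos : ∀ r ∈ Icc 1 (n - 1), 0 < B r)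
    (v : ℕ → ℝ)
    (hmono : ∀ r ∈ Icc 1 (n - 1), v (r + 1) ≤ v r)
    (hnonneg : ∀ r ∈ Icc 1 n, 0 ≤ v r)
    (hvsum : ∑ r ∈ Icc 1 n, v r = 1)
    (htop : ∀ r ∈ Icc 1 ((n + 1) / 2), v r = v 1)
    (L : ℝ)
    (hL : L = -(1 / (n : ℝ)) * ∑ r ∈ Icc 1 n, ∑ s ∈ Ico 1 r, (β r + β s) * (v s - v r))
    (R : ℝ) (hR : R = ∑ r ∈ Icc 1 n, β r * v r)
    (M : ℝ → ℝ) (hM : ∀ θ, M θ = R + θ * L) :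
    0 ≤ L ∧
      ∀ g : ℝ → ℝ, StrictMono g → ∀ θ θ' x x', 0 ≤ θ → θ < θ' → θ' ≤ 1 →
        g x = M θ → g x' = M θ' → x ≤ x' := by
  have hS : ∑ r ∈ Icc 1 n, ∑ s ∈ Ico 1 r, (β r + β s) * (v s - v r) ≤ 0 := by
    rw [sum_pairs_add_mul_sub]
    refine sum_nonpos fun k hk => ?_
    obtain ⟨hk1, hkn⟩ := mem_Icc.1 hk
    rcases hkn.eq_or_lt with rfl | hlt
    · simp
    rw [hβsum, ← hB]
    by_cases hkt : k + 1 ≤ (n + 1) / 2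
    · rw [htop k (mem_Icc.2 ⟨hk1, by omega⟩), htop (k + 1) (mem_Icc.2 ⟨by omega, hkt⟩)]
      simp
    · have hk' : k ∈ Icc 1 (n - 1) := mem_Icc.2 ⟨hk1, by omega⟩
      have hd : 0 ≤ v k - v (k + 1) := sub_nonneg.2 (hmono k hk')
      have hc : (n : ℝ) - 2 * k ≤ 0 := by
        have : (n : ℝ) ≤ 2 * k := by exact_mod_cast (by omega : n ≤ 2 * k)
        linarith
      refine mul_nonpos_of_nonpos_of_nonneg ?_ hd
      linarith [mul_nonpos_of_nonpos_of_nonneg hc (hBpos k hk').le]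
  have hL0 : 0 ≤ L := by
    rw [hL]
    exact mul_nonneg_of_nonpos_of_nonpos (neg_nonpos.2 (by positivity)) hS
  refine ⟨hL0, fun g hg θ θ' x x' _ hθ _ hx hx' => hg.le_iff_le.1 ?_⟩
  rw [hx, hx', hM, hM]
  gcongr
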